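/- For an integer N ≥ 1 and a function g : {0,1}^N → ℝ, define for each n ∈ {1,…,N} the sequential bargaining payoff π_n(g) := 2^{-(N-n+1)} · Σ_{I ∈ {0,1}^{N-n}} ( g(1^{n-1}, 1, I) − g(1^{n-1}, 0, I) ), where (1^{n-1}, b, I) denotes the vector whose first n−1 coordinates equal 1, whose n-th coordinate equals b, and whose last N−n coordinates are given by I. Suppose g is submodular, i.e., g(I ∨ J) + g(I ∧ J) ≤ g(I) + g(J) for all I, J ∈ {0,1}^N. Then for every n ∈ {1,…,N}, π_n(g) ≥ ( g(1,…,1) − g(ê_n) ) / 2, where ê_n ∈ {0,1}^N has all coordinates equal to 1 except the n-th, which is 0. (Concurrently moving tragedy: each APO's payoff under the concurrent bargaining, namely half the marginal social welfare it generates when all other APOs reach agreement, is at most its payoff in any position of the sequential bargaining.) -/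

import Mathlib

/-- The agreement vector `(1^{n-1}, b, I)` (in 1-indexed notation). -/
def extendVec {N : ℕ} (n : ℕ) (b : Bool) (I : Fin (N - n) → Bool) :
    Fin N → Bool :=
  fun i =>
    if i.val < n - 1 then true
    else if i.val = n - 1 then b
    else if h : i.val - n < N - n then I ⟨i.val - n, h⟩ else true

/-- APO `n`'s payoff in the sequential bargaining (1-indexed). -/
noncomputable def seqPayoff {N : ℕ} (g : (Fin N → Bool) → ℝ) (n : ℕ) : ℝ :=
  (∑ I : Fin (N - n) → Bool,
    (g (extendVec n true I) - g (extendVec n false I))) / 2 ^ (N - n + 1)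

/-- Under submodularity, the marginal value of coordinate `n` at any agreement vector is at least
its marginal value at the all-ones vector. -/
theorem marginal_top_le_marginal_extendVec {N : ℕ} (g : (Fin N → Bool) → ℝ)
    (hsub : ∀ I J : Fin N → Bool,
      g (fun i => I i || J i) + g (fun i => I i && J i) ≤ g I + g J)
    (n : ℕ) (I : Fin (N - n) → Bool) :
    g (fun _ => true) - g (fun i => if i.val = n - 1 then false else true)
      ≤ g (extendVec n true I) - g (extendVec n false I) := by
  have h := hsub (extendVec n true I) (fun i => if i.val = n - 1 then false else true)
  have hor : (fun i : Fin N => extendVec n true I i || if i.val = n - 1 then false else true)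
      = fun _ => true := by
    funext i
    by_cases hi : i.val = n - 1 <;> simp [extendVec, hi]
  have hand : (fun i : Fin N => extendVec n true I i && if i.val = n - 1 then false else true)
      = extendVec n false I := by
    funext i
    by_cases hi : i.val = n - 1 <;> simp [extendVec, hi]
  rw [hor, hand] at h
  linarith

/-- Concurrently moving tragedy: if `g` is submodular, then the concurrent
bargaining payoff of APO `n`, namely half the marginal social welfare
`(g(1,…,1) − g(ê_n))/2` it generates when all other APOs reach agreement,
is at most its sequential bargaining payoff in any position `n`. -/
theorem concurrent_moving_tragedy {N : ℕ} (g : (Fin N → Bool) → ℝ)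
    (hsub : ∀ I J : Fin N → Bool,
      g (fun i => I i || J i) + g (fun i => I i && J i) ≤ g I + g J) :
    ∀ n : ℕ, 1 ≤ n → n ≤ N →
      (g (fun _ => true) - g (fun i => if i.val = n - 1 then false else true)) / 2
        ≤ seqPayoff g n := by
  intro n _ _
  have h := Finset.card_nsmul_le_sum Finset.univ _ _
    fun I (_ : I ∈ Finset.univ) => marginal_top_le_marginal_extendVec g hsub n I
  simp only [Finset.card_univ, Fintype.card_fun, Fintype.card_bool, Fintype.card_fin,
    nsmul_eq_mul, Nat.cast_pow, Nat.cast_ofNat] at h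
  rw [seqPayoff, le_div_iff₀ (by positivity), pow_succ]
  linarith
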